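/- arXiv:math/0609730 — 2 statements merged into one kernel-verified Lean document; each statement's English description precedes it below -/
import Mathlib

section
/- Let g(x) = (1/√(2π)) e^{−x²/2} and G(x) = ∫_{−∞}^x g(u) du. Then g(G⁻¹(y)) ~ y·√(−2 log y) as y → 0⁺, and g(G⁻¹(y)) ~ (1−y)·√(−2 log(1−y)) as y → 1⁻. -/
open MeasureTheory Real Filter

open ProbabilityTheory Topology

local notation "φ" => gaussianPDFReal 0 1

local notation "Φ" => (cdf (gaussianReal 0 1) : ℝ → ℝ)

theorem stdGaussianPDF_apply (x : ℝ) :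
    φ x = (1 / Real.sqrt (2 * π)) * Real.exp (-x ^ 2 / 2) := by
  simp [gaussianPDFReal]

theorem stdGaussianPDF_pos (x : ℝ) : 0 < φ x := gaussianPDFReal_pos 0 1 x one_ne_zero

theorem stdGaussianPDF_neg (x : ℝ) : φ (-x) = φ x := by
  simp [stdGaussianPDF_apply]

theorem hasDerivAt_stdGaussianPDF (x : ℝ) : HasDerivAt φ (-x * φ x) x := by
  have h : HasDerivAt (fun x : ℝ => -x ^ 2 / 2) (-x) x := by
    refine ((hasDerivAt_pow 2 x).neg.div_const 2).congr_deriv ?_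
    norm_num
    ring
  have h' := h.exp.const_mul (1 / Real.sqrt (2 * π))
  rw [show φ = fun x => (1 / Real.sqrt (2 * π)) * Real.exp (-x ^ 2 / 2) from
    funext stdGaussianPDF_apply]
  exact h'.congr_deriv (by ring)

theorem continuous_stdGaussianPDF : Continuous φ :=
  continuous_iff_continuousAt.2 fun x => (hasDerivAt_stdGaussianPDF x).continuousAt

theorem stdGaussianCDF_eq_integral (x : ℝ) : Φ x = ∫ u in Set.Iic x, φ u := by
  rw [cdf_eq_real, Measure.real, gaussianReal_apply_eq_integral _ one_ne_zero,
    ENNReal.toReal_ofReal]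
  exact integral_nonneg fun u => (stdGaussianPDF_pos u).le

theorem hasDerivAt_stdGaussianCDF (x : ℝ) : HasDerivAt Φ (φ x) x := by
  have hi := integrable_gaussianPDFReal 0 1
  have h : Φ = fun x => Φ 0 + ∫ u in (0 : ℝ)..x, φ u := by
    funext x
    rw [← intervalIntegral.integral_Iic_sub_Iic hi.integrableOn hi.integrableOn,
      stdGaussianCDF_eq_integral, stdGaussianCDF_eq_integral]
    ring
  rw [h]
  exact (intervalIntegral.integral_hasDerivAt_right
    (continuous_stdGaussianPDF.intervalIntegrable _ _)
    (continuous_stdGaussianPDF.stronglyMeasurableAtFilter _ _)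
    continuous_stdGaussianPDF.continuousAt).const_add _

theorem strictMono_stdGaussianCDF : StrictMono Φ :=
  strictMono_of_deriv_pos fun x => by
    rw [(hasDerivAt_stdGaussianCDF x).deriv]
    exact stdGaussianPDF_pos x

theorem stdGaussianCDF_pos (x : ℝ) : 0 < Φ x :=
  (cdf_nonneg _ (x - 1)).trans_lt (strictMono_stdGaussianCDF (sub_one_lt x))

theorem stdGaussianCDF_neg (x : ℝ) : Φ (-x) = 1 - Φ x := by
  have hi := integrable_gaussianPDFReal 0 1
  have h := intervalIntegral.integral_Iic_add_Ioi (b := x) hi.integrableOn hi.integrableOn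
  have h' := integral_comp_neg_Iic (-x) φ
  simp only [stdGaussianPDF_neg, neg_neg] at h'
  rw [integral_gaussianPDFReal_eq_one 0 one_ne_zero] at h
  rw [stdGaussianCDF_eq_integral, stdGaussianCDF_eq_integral, h']
  linarith

theorem stdGaussianCDF_invFun {y : ℝ} (h0 : 0 < y) (h1 : y < 1) :
    Φ (Function.invFun Φ y) = y := by
  refine Function.invFun_eq (mem_range_of_exists_le_of_exists_ge
    (continuous_iff_continuousAt.2 fun x => (hasDerivAt_stdGaussianCDF x).continuousAt) ?_ ?_)
  · exact (((tendsto_cdf_atBot _).eventually (eventually_lt_nhds h0)).exists).imp fun _ h => h.le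
  · exact (((tendsto_cdf_atTop _).eventually (eventually_gt_nhds h1)).exists).imp fun _ h => h.le

theorem invFun_stdGaussianCDF_one_sub {y : ℝ} (h0 : 0 < y) (h1 : y < 1) :
    Function.invFun Φ (1 - y) = -Function.invFun Φ y := by
  apply strictMono_stdGaussianCDF.injective
  rw [stdGaussianCDF_neg, stdGaussianCDF_invFun h0 h1,
    stdGaussianCDF_invFun (by linarith) (by linarith)]

theorem tendsto_invFun_stdGaussianCDF :
    Tendsto (Function.invFun Φ) (𝓝[>] 0) atBot := by
  refine tendsto_atBot.2 fun M => ?_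
  have h : ∀ᶠ y in 𝓝[>] (0 : ℝ), y < min (Φ M) 1 :=
    nhdsWithin_le_nhds (eventually_lt_nhds (lt_min (stdGaussianCDF_pos M) one_pos))
  filter_upwards [h, self_mem_nhdsWithin] with y hy hy0
  rw [← strictMono_stdGaussianCDF.le_iff_le,
    stdGaussianCDF_invFun hy0 (hy.trans_le (min_le_right _ _))]
  exact (hy.trans_le (min_le_left _ _)).le

theorem tendsto_sq_atBot_atTop : Tendsto (fun x : ℝ => x ^ 2) atBot atTop :=
  (tendsto_id.atBot_mul_atBot₀ tendsto_id).congr fun x => (sq x).symm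

theorem tendsto_inv_sq_atBot : Tendsto (fun x : ℝ => (x ^ 2)⁻¹) atBot (𝓝 0) :=
  tendsto_inv_atTop_zero.comp tendsto_sq_atBot_atTop

theorem tendsto_stdGaussianPDF_atBot : Tendsto φ atBot (𝓝 0) := by
  have h : Tendsto (fun x : ℝ => -x ^ 2 / 2) atBot atBot :=
    (tendsto_neg_atTop_atBot.comp
      tendsto_sq_atBot_atTop).atBot_div_const two_pos
  have h' := (Real.tendsto_exp_atBot.comp h).const_mul (1 / Real.sqrt (2 * π))
  rw [mul_zero] at h'
  exact h'.congr fun x => (stdGaussianPDF_apply x).symm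

/-- The Mills ratio of the standard Gaussian at `-∞`. -/
theorem tendsto_stdGaussianCDF_div_atBot :
    Tendsto (fun x => Φ x / (φ x / -x)) atBot (𝓝 1) := by
  refine HasDerivAt.lhopital_zero_atBot (f' := φ) (g' := fun x => φ x * (1 + (x ^ 2)⁻¹))
    (Eventually.of_forall hasDerivAt_stdGaussianCDF) ?_ ?_ (tendsto_cdf_atBot _) ?_ ?_
  · filter_upwards [eventually_lt_atBot (0 : ℝ)] with x hx
    refine ((hasDerivAt_stdGaussianPDF x).div (hasDerivAt_neg x) (by linarith)).congr_deriv ?_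
    have := hx.ne
    field_simp
    ring
  · refine Eventually.of_forall fun x => (mul_pos (stdGaussianPDF_pos x) ?_).ne'
    positivity
  · simpa [div_eq_mul_inv, Function.comp_def] using tendsto_stdGaussianPDF_atBot.mul
      (tendsto_inv_atTop_zero.comp tendsto_neg_atBot_atTop)
  · have h : Tendsto (fun x : ℝ => (1 + (x ^ 2)⁻¹)⁻¹) atBot (𝓝 1) := by
      simpa using (tendsto_inv_sq_atBot.const_add 1).inv₀ (by norm_num)
    refine h.congr fun x => ?_
    have := (stdGaussianPDF_pos x).ne'
    rw [div_mul_eq_div_div, div_self this, one_div]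

theorem tendsto_log_neg_div_sq_atBot :
    Tendsto (fun x : ℝ => Real.log (-x) / x ^ 2) atBot (𝓝 0) := by
  have h1 := Real.isLittleO_log_id_atTop.tendsto_div_nhds_zero.comp tendsto_neg_atBot_atTop
  have h2 := h1.mul (tendsto_inv_atTop_zero.comp tendsto_neg_atBot_atTop)
  rw [mul_zero] at h2
  refine h2.congr fun x => ?_
  simp only [Function.comp_apply, id_eq]
  rw [← div_eq_mul_inv, div_div]
  ring_nf

theorem tendsto_neg_two_log_stdGaussianCDF_div_sq :
    Tendsto (fun x => -2 * Real.log (Φ x) / x ^ 2) atBot (𝓝 1) := by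
  have hc : 0 < 1 / Real.sqrt (2 * π) := by positivity
  have h1 := (tendsto_stdGaussianCDF_div_atBot.log one_ne_zero).mul tendsto_inv_sq_atBot
  have h2 := tendsto_inv_sq_atBot.const_mul (Real.log (1 / Real.sqrt (2 * π)))
  have h := ((h1.add h2).sub tendsto_log_neg_div_sq_atBot).const_mul (-2) |>.const_add 1
  simp only [mul_zero, add_zero, sub_zero] at h
  refine h.congr' ?_
  filter_upwards [eventually_lt_atBot (0 : ℝ)] with x hx
  have hφ := stdGaussianPDF_pos x
  rw [Real.log_div (stdGaussianCDF_pos x).ne' (div_pos hφ (by linarith)).ne',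
    Real.log_div hφ.ne' (by linarith), stdGaussianPDF_apply,
    Real.log_mul hc.ne' (Real.exp_pos _).ne', Real.log_exp]
  have := hx.ne
  field_simp
  ring

theorem tendsto_stdGaussianPDF_div_atBot :
    Tendsto (fun x => φ x / (Φ x * Real.sqrt (-2 * Real.log (Φ x)))) atBot (𝓝 1) := by
  have h := (tendsto_stdGaussianCDF_div_atBot.mul
    tendsto_neg_two_log_stdGaussianCDF_div_sq.sqrt).inv₀ (by simp)
  rw [Real.sqrt_one, mul_one, inv_one] at h
  refine h.congr' ?_
  filter_upwards [eventually_lt_atBot (0 : ℝ)] with x hx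
  rw [Real.sqrt_div' _ (sq_nonneg x), Real.sqrt_sq_eq_abs, abs_of_neg hx]
  have hne : -x ≠ 0 := by linarith
  rw [mul_inv, inv_div, inv_div, div_div, div_mul_div_comm, mul_assoc, mul_comm (φ x),
    mul_div_mul_left _ _ hne]

/-- **Asymptotics of `g ∘ G⁻¹` near 0 and 1.**
With `g` the standard Gaussian density and `G` its distribution function,
`g(G⁻¹(y)) ∼ y √(−2 log y)` as `y → 0⁺` and
`g(G⁻¹(y)) ∼ (1−y) √(−2 log(1−y))` as `y → 1⁻`. -/
theorem gaussian_density_inv_cdf_asymptotics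
    (g G : ℝ → ℝ)
    (hg : ∀ x, g x = (1 / Real.sqrt (2 * π)) * Real.exp (-x ^ 2 / 2))
    (hG : ∀ x, G x = ∫ u in Set.Iic x, g u) :
    Tendsto (fun y => g (Function.invFun G y) / (y * Real.sqrt (-2 * Real.log y)))
      (nhdsWithin 0 (Set.Ioi 0)) (nhds 1) ∧
    Tendsto (fun y => g (Function.invFun G y) / ((1 - y) * Real.sqrt (-2 * Real.log (1 - y))))
      (nhdsWithin 1 (Set.Iio 1)) (nhds 1) := by
  obtain rfl : g = φ := funext fun x => (hg x).trans (stdGaussianPDF_apply x).symm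
  obtain rfl : G = Φ := funext fun x => (hG x).trans (stdGaussianCDF_eq_integral x).symm
  have h0 : Tendsto (fun y => φ (Function.invFun Φ y) / (y * Real.sqrt (-2 * Real.log y)))
      (𝓝[>] 0) (𝓝 1) := by
    refine (tendsto_stdGaussianPDF_div_atBot.comp tendsto_invFun_stdGaussianCDF).congr' ?_
    filter_upwards [Ioo_mem_nhdsGT one_pos] with y hy
    simp only [Function.comp_apply, stdGaussianCDF_invFun hy.1 hy.2]
  have hsub : Tendsto (fun y : ℝ => 1 - y) (𝓝[<] 1) (𝓝[>] 0) := by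
    refine tendsto_nhdsWithin_iff.2 ⟨?_, ?_⟩
    · exact ((continuous_const.sub continuous_id).tendsto' 1 0 (sub_self 1)).mono_left
        nhdsWithin_le_nhds
    · filter_upwards [self_mem_nhdsWithin] with y hy using sub_pos.2 (Set.mem_Iio.1 hy)
  refine ⟨h0, (h0.comp hsub).congr' ?_⟩
  filter_upwards [Ioo_mem_nhdsLT one_pos] with y hy
  simp only [Function.comp_apply, invFun_stdGaussianCDF_one_sub hy.1 hy.2, stdGaussianPDF_neg]
end

section
/- There exists a constant c > 0 such that for every positive integer m there exists a function g_m : {0,1}^{m²} → {0, 1, …, m} satisfying: (a) max_{y ∈ {0,…,m}} λ( { x ∈ {0,1}^{m²} : g_m(x) = y } ) ≤ c/m, where λ is the uniform probability measure on {0,1}^{m²}; and (b) for every q ∈ {1,…,m²}, ∇_q g_m(x) ∈ {0,1} for all x, where ∇_q g(x) = g(x₁,…,x_{q−1},1,x_{q+1},…,x_{m²}) − g(x₁,…,x_{q−1},0,x_{q+1},…,x_{m²}). -/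
open Finset

theorem two_mul_add_one_mul_centralBinom_sq_le (j : ℕ) :
    (2 * j + 1) * j.centralBinom ^ 2 ≤ 16 ^ j := by
  induction j with
  | zero => simp
  | succ j ih =>
    have h := Nat.succ_mul_centralBinom_succ j
    refine Nat.le_of_mul_le_mul_left (c := (j + 1) ^ 2) ?_ (by positivity)
    calc (j + 1) ^ 2 * ((2 * (j + 1) + 1) * (j + 1).centralBinom ^ 2)
        = (2 * j + 3) * ((j + 1) * (j + 1).centralBinom) ^ 2 := by ring
      _ = 4 * ((2 * j + 3) * (2 * j + 1)) * ((2 * j + 1) * j.centralBinom ^ 2) := by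
          rw [h]; ring
      _ ≤ 4 * (4 * (j + 1) ^ 2) * 16 ^ j := by
          refine Nat.mul_le_mul (Nat.mul_le_mul le_rfl ?_) ih
          nlinarith
      _ = (j + 1) ^ 2 * 16 ^ (j + 1) := by ring

theorem mul_choose_half_sq_le (n : ℕ) : n * (n.choose (n / 2)) ^ 2 ≤ 4 ^ n := by
  obtain ⟨j, rfl | rfl⟩ := Nat.even_or_odd' n
  · have h := two_mul_add_one_mul_centralBinom_sq_le j
    rw [Nat.mul_div_cancel_left j two_pos, ← Nat.centralBinom_eq_two_mul_choose, pow_mul]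
    norm_num
    nlinarith
  · have h := two_mul_add_one_mul_centralBinom_sq_le (j + 1)
    have h2 : (j + 1).centralBinom = 2 * (2 * j + 1).choose j := by
      rw [Nat.centralBinom_eq_two_mul_choose, show 2 * (j + 1) = (2 * j + 1) + 1 by ring,
        Nat.choose_succ_succ, Nat.choose_symm_half]
      ring
    have h3 : (2 * j + 1) / 2 = j := by omega
    rw [h2, pow_succ 16] at h
    rw [h3, pow_succ 4, pow_mul]
    norm_num at h ⊢
    nlinarith [sq_nonneg ((2 * j + 1).choose j)]

theorem mul_choose_sq_le_two_pow (m k : ℕ) : m * (m ^ 2).choose k ≤ 2 ^ m ^ 2 := by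
  refine (Nat.mul_le_mul_left m (Nat.choose_le_middle k (m ^ 2))).trans ?_
  rw [← Nat.pow_le_pow_iff_left (n := 2) two_ne_zero, mul_pow, ← pow_mul, mul_comm (m ^ 2) 2,
    pow_mul]
  exact mul_choose_half_sq_le (m ^ 2)

/-- The Hamming weight of a point of the discrete cube. -/
def cubeWeight {n : ℕ} (x : Fin n → Bool) : ℕ := (univ.filter fun i => x i = true).card

theorem cubeWeight_le {n : ℕ} (x : Fin n → Bool) : cubeWeight x ≤ n :=
  (card_filter_le _ _).trans (by simp)

theorem cubeWeight_update_true {n : ℕ} (x : Fin n → Bool) (q : Fin n) :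
    cubeWeight (Function.update x q true) = cubeWeight (Function.update x q false) + 1 := by
  have h : (univ.filter fun i => Function.update x q true i = true)
      = insert q (univ.filter fun i => Function.update x q false i = true) := by
    ext i
    by_cases hi : i = q <;> simp [Function.update_apply, hi]
  rw [cubeWeight, h, card_insert_of_notMem (by simp), cubeWeight]

theorem card_cubeWeight_eq (n k : ℕ) :
    (univ.filter fun x : Fin n → Bool => cubeWeight x = k).card = n.choose k := by
  calc _ = (powersetCard k (univ : Finset (Fin n))).card := by
        refine card_nbij' (fun x => univ.filter fun i => x i = true) (fun s i => decide (i ∈ s))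
          ?_ ?_ ?_ ?_
        · intro x hx
          exact mem_coe.2 (mem_powersetCard.2 ⟨subset_univ _, (mem_filter.1 (mem_coe.1 hx)).2⟩)
        · intro s hs
          refine mem_coe.2 (mem_filter.2 ⟨mem_univ _, ?_⟩)
          simpa [cubeWeight] using (mem_powersetCard.1 (mem_coe.1 hs)).2
        · intro x _
          ext i
          simp
        · intro s _
          ext i
          simp
    _ = n.choose k := by simp

/-- The rescaled distribution function of the Hamming weight on `{0,1}^{m²}`, rounded down. -/
def binomialQuantile (m k : ℕ) : ℕ := m * (∑ i ∈ range k, (m ^ 2).choose i) / 2 ^ m ^ 2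

theorem binomialQuantile_le {m k : ℕ} (hk : k ≤ m ^ 2) : binomialQuantile m k ≤ m := by
  refine Nat.div_le_of_le_mul ?_
  rw [mul_comm, ← Nat.sum_range_choose]
  exact Nat.mul_le_mul_right _
    (sum_le_sum_of_subset (range_subset_range.2 (hk.trans (Nat.le_succ _))))

theorem binomialQuantile_le_succ (m k : ℕ) :
    binomialQuantile m k ≤ binomialQuantile m (k + 1) := by
  refine Nat.div_le_div_right (Nat.mul_le_mul_left _ ?_)
  rw [sum_range_succ]
  exact Nat.le_add_right _ _

theorem binomialQuantile_succ_le (m k : ℕ) :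
    binomialQuantile m (k + 1) ≤ binomialQuantile m k + 1 := by
  rw [binomialQuantile, binomialQuantile, ← Nat.add_div_right _ (by positivity)]
  refine Nat.div_le_div_right ?_
  rw [sum_range_succ, mul_add]
  exact Nat.add_le_add_left (mul_choose_sq_le_two_pow m k) _

theorem mul_card_binomialQuantile_eq_le (m y : ℕ) :
    m * (univ.filter fun x : Fin (m ^ 2) → Bool => binomialQuantile m (cubeWeight x) = y).card
      ≤ 2 * 2 ^ m ^ 2 := by
  set T := univ.filter fun x : Fin (m ^ 2) → Bool => binomialQuantile m (cubeWeight x) = y with hT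
  obtain hE | hE := T.eq_empty_or_nonempty
  · simp [hE]
  obtain ⟨a, haT, ha⟩ := exists_min_image T cubeWeight hE
  obtain ⟨b, hbT, hb⟩ := exists_max_image T cubeWeight hE
  have hab := ha b hbT
  have hcard : T.card ≤ ∑ i ∈ Ico (cubeWeight a) (cubeWeight b + 1), (m ^ 2).choose i := by
    rw [card_eq_sum_card_fiberwise (f := cubeWeight)
      (t := Ico (cubeWeight a) (cubeWeight b + 1))]
    · refine sum_le_sum fun i _ => ?_
      rw [← card_cubeWeight_eq]
      exact card_le_card (filter_subset_filter _ (subset_univ _))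
    · intro x hx
      simpa [Nat.lt_succ_iff] using ⟨ha x hx, hb x hx⟩
  have hsum := sum_range_add_sum_Ico (fun i => (m ^ 2).choose i)
    (hab.trans (Nat.le_succ (cubeWeight b)))
  rw [Nat.succ_eq_add_one, sum_range_succ] at hsum
  have h1 : y * 2 ^ m ^ 2 ≤ m * ∑ i ∈ range (cubeWeight a), (m ^ 2).choose i := by
    rw [← (mem_filter.1 haT).2]
    exact Nat.div_mul_le_self _ _
  have h2 : m * ∑ i ∈ range (cubeWeight b), (m ^ 2).choose i < (y + 1) * 2 ^ m ^ 2 := by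
    rw [← (mem_filter.1 hbT).2, mul_comm (_ + 1)]
    exact Nat.lt_mul_div_succ _ (by positivity)
  have h3 := mul_choose_sq_le_two_pow m (cubeWeight b)
  have h4 := congrArg (m * ·) hsum
  simp only [mul_add] at h4
  have h5 := Nat.mul_le_mul_left m hcard
  linarith

/-- **Averaging lemma (Benjamini–Kalai–Schramm randomisation).**
There is a constant `c > 0` such that for every `m ≥ 1` there is a function
`g_m : {0,1}^{m²} → {0,…,m}` whose level sets all have uniform measure at most `c/m`
and whose discrete gradients `∇_q g_m` take values in `{0,1}`. -/
theorem averaging_function_exists :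
    ∃ c : ℝ, 0 < c ∧
      ∀ m : ℕ, 0 < m →
        ∃ gm : (Fin (m ^ 2) → Bool) → ℕ,
          (∀ x, gm x ≤ m) ∧
          (∀ y : ℕ, y ≤ m →
            ((Finset.univ.filter fun x : Fin (m ^ 2) → Bool => gm x = y).card : ℝ)
                / 2 ^ (m ^ 2) ≤ c / m) ∧
          (∀ q : Fin (m ^ 2), ∀ x : Fin (m ^ 2) → Bool,
            (gm (Function.update x q true) : ℤ) - (gm (Function.update x q false) : ℤ)
              ∈ ({0, 1} : Set ℤ)) := by
  refine ⟨2, two_pos, fun m hm => ⟨fun x => binomialQuantile m (cubeWeight x),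
    fun x => binomialQuantile_le (cubeWeight_le x), fun y _ => ?_, fun q x => ?_⟩⟩
  · rw [div_le_div_iff₀ (by positivity) (by exact_mod_cast hm), mul_comm]
    exact_mod_cast mul_card_binomialQuantile_eq_le m y
  · have h1 := binomialQuantile_le_succ m (cubeWeight (Function.update x q false))
    have h2 := binomialQuantile_succ_le m (cubeWeight (Function.update x q false))
    simp only [cubeWeight_update_true, Set.mem_insert_iff, Set.mem_singleton_iff]
    omega
end
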